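/- For every SPSS M = (Π, σ, γ, ≺), every standpoint expression e ∈ E, and all formulas α, β ∈ L: M ⊩ (□_e α) ⤳ β if and only if either ⟦□_e α⟧^M = ∅ or M ⊩ ⊡_* β. -/

import Mathlib

/-- Standpoint expressions over a set `S` of standpoint symbols:
`e ::= * | s | -e | e ∩ e`. -/
inductive SE (S : Type) : Type where
  | star : SE S
  | atom : S → SE S
  | compl : SE S → SE S
  | inter : SE S → SE S → SE S

/-- `e ∪ d := -(-e ∩ -d)` -/
def SE.union {S : Type} (e d : SE S) : SE S := .compl (.inter (.compl e) (.compl d))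

/-- `e \ d := e ∩ -d` -/
def SE.diff {S : Type} (e d : SE S) : SE S := .inter e (.compl d)

/-- Formulas of the language L:
`α ::= ⊤ | p | e ≲ d | ¬α | α ∧ α | □_e α | ⊡_e α | α ⤳ α`. -/
inductive Fml (P S : Type) : Type where
  | top : Fml P S
  | atom : P → Fml P S
  | dsharp : SE S → SE S → Fml P S   -- e ≲ d
  | neg : Fml P S → Fml P S
  | and : Fml P S → Fml P S → Fml P S
  | box : SE S → Fml P S → Fml P S   -- □_e α
  | dbox : SE S → Fml P S → Fml P S  -- ⊡_e α
  | dimp : Fml P S → Fml P S → Fml P S  -- α ⤳ β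

def Fml.bot {P S : Type} : Fml P S := .neg .top
def Fml.or {P S : Type} (a b : Fml P S) : Fml P S := .neg (.and (.neg a) (.neg b))
def Fml.imp {P S : Type} (a b : Fml P S) : Fml P S := Fml.or (.neg a) b
/-- `◇_e α := ¬□_e ¬α` -/
def Fml.dia {P S : Type} (e : SE S) (a : Fml P S) : Fml P S := .neg (.box e (.neg a))
/-- `⟐_e α := ¬⊡_e ¬α` -/
def Fml.ddia {P S : Type} (e : SE S) (a : Fml P S) : Fml P S := .neg (.dbox e (.neg a))
/-- `e ≤ d := □_{e \ d} ⊥` -/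
def Fml.sharp {P S : Type} (e d : SE S) : Fml P S := .box (SE.diff e d) Fml.bot

/-- A state-preferential standpoint structure (SPSS) with precisifications
drawn from the type `W`. -/
structure SPSS (P S W : Type) : Type where
  nonempty : Nonempty W
  σ : SE S → Set W
  σ_star : σ .star = Set.univ
  σ_inter : ∀ e d, σ (.inter e d) = σ e ∩ σ d
  σ_compl : ∀ e, σ (.compl e) = (σ e)ᶜ
  σ_atom : ∀ s : S, (σ (.atom s)).Nonempty
  γ : W → Set P
  prec : W → W → Prop
  prec_irrefl : ∀ w, ¬ prec w w
  prec_trans : ∀ a b c, prec a b → prec b c → prec a c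
  prec_wf : ∀ (X : Set W), ∀ π ∈ X,
      (∀ π' ∈ X, ¬ prec π' π) ∨
        ∃ π' ∈ X, (∀ π'' ∈ X, ¬ prec π'' π') ∧ prec π' π

/-- `min_≺ X` : the set of ≺-minimal elements of `X`. -/
def SPSS.minOf {P S W : Type} (M : SPSS P S W) (X : Set W) : Set W :=
  {π ∈ X | ∀ π' ∈ X, ¬ M.prec π' π}

/-- Satisfaction `M, π ⊩ α`. -/
def SPSS.sat {P S W : Type} (M : SPSS P S W) : W → Fml P S → Prop
  | _, .top => True
  | π, .atom p => p ∈ M.γ π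
  | _, .dsharp e d => M.minOf (M.σ e) ⊆ M.σ d
  | π, .neg a => ¬ M.sat π a
  | π, .and a b => M.sat π a ∧ M.sat π b
  | _, .box e a => ∀ π' ∈ M.σ e, M.sat π' a
  | _, .dbox e a => ∀ π' ∈ M.minOf (M.σ e), M.sat π' a
  | π, .dimp a b => π ∉ M.minOf {π' | M.sat π' a} ∨ M.sat π b

/-- `⟦α⟧^M` -/
def SPSS.states {P S W : Type} (M : SPSS P S W) (a : Fml P S) : Set W :=
  {π | M.sat π a}

/-- `M ⊩ α` : global satisfaction. -/
def SPSS.gsat {P S W : Type} (M : SPSS P S W) (a : Fml P S) : Prop :=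
  ∀ π : W, M.sat π a

/-- Conjunction `⋀K` of a finite knowledge base (given as a list). -/
def listConj {P S : Type} : List (Fml P S) → Fml P S
  | [] => .top
  | a :: rest => .and a (listConj rest)

theorem SPSS.sat_box_iff {P S W : Type} (M : SPSS P S W) (π : W) (e : SE S) (α : Fml P S) :
    M.sat π (.box e α) ↔ ∀ π' ∈ M.σ e, M.sat π' α := by
  simp only [SPSS.sat]

theorem SPSS.gsat_dimp_iff {P S W : Type} (M : SPSS P S W) (α β : Fml P S) :
    M.gsat (.dimp α β) ↔ ∀ π ∈ M.minOf (M.states α), M.sat π β := by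
  simp only [SPSS.gsat, SPSS.sat, SPSS.states, imp_iff_not_or]

theorem SPSS.gsat_dbox_star_iff {P S W : Type} (M : SPSS P S W) (β : Fml P S) :
    M.gsat (.dbox .star β) ↔ ∀ π ∈ M.minOf Set.univ, M.sat π β := by
  have := M.nonempty
  simp only [SPSS.gsat, SPSS.sat, M.σ_star, forall_const]

/-- The truth of `□_e α` does not depend on the precisification. -/
theorem SPSS.states_box_eq_empty_or_univ {P S W : Type} (M : SPSS P S W) (e : SE S)
    (α : Fml P S) : M.states (.box e α) = ∅ ∨ M.states (.box e α) = Set.univ := by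
  by_cases h : ∀ π' ∈ M.σ e, M.sat π' α
  · exact .inr (Set.eq_univ_of_forall fun π => (M.sat_box_iff π e α).2 h)
  · exact .inl (Set.eq_empty_of_forall_notMem fun π hπ => h ((M.sat_box_iff π e α).1 hπ))

/-- `M ⊩ (□_e α) ⤳ β` iff `⟦□_e α⟧^M = ∅` or `M ⊩ ⊡_* β`. -/
theorem dimp_box_characterization {P S : Type} [Finite S] [Nonempty S] {W : Type}
    (M : SPSS P S W) (e : SE S) (α β : Fml P S) :
    M.gsat (.dimp (.box e α) β) ↔
      (M.states (.box e α) = ∅ ∨ M.gsat (.dbox .star β)) := by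
  have := M.nonempty
  rw [M.gsat_dimp_iff, M.gsat_dbox_star_iff]
  rcases M.states_box_eq_empty_or_univ e α with h | h
  · simp [h, SPSS.minOf]
  · simp [h]
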